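/- Let T > 0, let α ∈ (0,1], let C_e ≥ 0, and let φ : [0,T] → ℝ be differentiable on [0,T] with |φ'(t) − φ'(s)| ≤ C_e·|t − s|^α for all s, t ∈ [0,T]. Then |(φ(0) + φ(T))/2 − (1/T)·∫₀^T φ(ξ) dξ| ≤ (C_e/((α+2)(α+3)))·T^{1+α}. -/

import Mathlib

open MeasureTheory intervalIntegral Set

theorem integral_abs_rpow_symm {T p : ℝ} (hT : 0 ≤ T) (hp : 0 ≤ p) :
    ∫ x in (-T)..T, |x| ^ p = 2 * (T ^ (p + 1) / (p + 1)) := by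
  have hc : Continuous fun x : ℝ ↦ |x| ^ p := continuous_abs.rpow_const fun _ ↦ Or.inr hp
  have hpos : ∫ x in (0 : ℝ)..T, |x| ^ p = T ^ (p + 1) / (p + 1) := by
    have hcongr : ∫ x in (0 : ℝ)..T, |x| ^ p = ∫ x in (0 : ℝ)..T, x ^ p :=
      integral_congr fun x hx ↦ by
        rw [uIcc_of_le hT] at hx
        simp only [abs_of_nonneg hx.1]
    rw [hcongr, integral_rpow (Or.inl (by linarith)), Real.zero_rpow (by positivity), sub_zero]
  have hneg : ∫ x in (-T)..0, |x| ^ p = ∫ x in (0 : ℝ)..T, |x| ^ p := by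
    simpa using (integral_comp_neg (a := 0) (b := T) fun x : ℝ ↦ |x| ^ p).symm
  rw [← integral_add_adjacent_intervals (hc.intervalIntegrable _ 0) (hc.intervalIntegrable 0 _),
    hneg, hpos, two_mul]

theorem continuousOn_of_abs_sub_le_mul_rpow {f : ℝ → ℝ} {s : Set ℝ} {C α : ℝ} (hα : 0 < α)
    (hf : ∀ x ∈ s, ∀ y ∈ s, |f y - f x| ≤ C * |y - x| ^ α) : ContinuousOn f s := by
  intro x hx
  have hc : Continuous fun y : ℝ ↦ C * |y - x| ^ α :=
    continuous_const.mul ((continuous_id.sub continuous_const).abs.rpow_const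
      fun _ ↦ Or.inr hα.le)
  have hlim : Filter.Tendsto (fun y : ℝ ↦ C * |y - x| ^ α) (nhdsWithin x s) (nhds 0) := by
    have h := (hc.tendsto x).mono_left (nhdsWithin_le_nhds (s := s))
    simpa [Real.zero_rpow hα.ne'] using h
  rw [ContinuousWithinAt, tendsto_iff_dist_tendsto_zero]
  refine squeeze_zero' (Filter.Eventually.of_forall fun _ ↦ dist_nonneg) ?_ hlim
  filter_upwards [self_mem_nhdsWithin] with y hy
  exact hf x hx y hy

/-- Twice the first moment of `f` about the midpoint, written through the odd part of `f`. -/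
theorem two_mul_integral_sub_midpoint_mul {f : ℝ → ℝ} {T : ℝ} (hT : 0 ≤ T)
    (hf : ContinuousOn f (Icc 0 T)) :
    2 * ∫ x in (0 : ℝ)..T, (x - T / 2) * f x =
      ∫ x in (0 : ℝ)..T, (x - T / 2) * (f x - f (T - x)) := by
  have hi : IntervalIntegrable (fun x ↦ (x - T / 2) * f x) volume 0 T := by
    apply ContinuousOn.intervalIntegrable_of_Icc hT
    fun_prop
  have hr : IntervalIntegrable (fun x ↦ (T - x - T / 2) * f (T - x)) volume 0 T := by
    simpa using (hi.comp_sub_left T).symm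
  have he : ∫ x in (0 : ℝ)..T, (T - x - T / 2) * f (T - x) =
      ∫ x in (0 : ℝ)..T, (x - T / 2) * f x := by
    simpa using integral_comp_sub_left (a := 0) (b := T) (fun x ↦ (x - T / 2) * f x) T
  rw [two_mul]
  nth_rw 2 [← he]
  rw [← integral_add hi hr]
  exact integral_congr fun x _ ↦ by ring

/-- The first moment of an `α`-Hölder function about the midpoint of `[0, T]`. -/
theorem abs_integral_sub_midpoint_mul_le {f : ℝ → ℝ} {T C α : ℝ} (hT : 0 ≤ T) (hα : 0 < α)
    (hf : ∀ s ∈ Icc 0 T, ∀ x ∈ Icc 0 T, |f x - f s| ≤ C * |x - s| ^ α) :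
    |∫ x in (0 : ℝ)..T, (x - T / 2) * f x| ≤ C / (4 * (α + 2)) * T ^ (α + 2) := by
  have hsym := two_mul_integral_sub_midpoint_mul hT (continuousOn_of_abs_sub_le_mul_rpow hα hf)
  have hbound : ‖∫ x in (0 : ℝ)..T, (x - T / 2) * (f x - f (T - x))‖ ≤
      ∫ x in (0 : ℝ)..T, C / 2 * |2 * x - T| ^ (1 + α) := by
    refine norm_integral_le_of_norm_le hT (ae_of_all _ fun x hx ↦ ?_) ?_
    · have h := hf (T - x) ⟨by linarith [hx.2], by linarith [hx.1]⟩ x ⟨hx.1.le, hx.2⟩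
      have hx2 : |x - T / 2| = |2 * x - T| / 2 := by
        rw [show x - T / 2 = (2 * x - T) / 2 by ring, abs_div, abs_two]
      rw [show x - (T - x) = 2 * x - T by ring] at h
      rw [Real.norm_eq_abs, abs_mul, hx2, Real.rpow_add_of_nonneg (abs_nonneg _) zero_le_one hα.le,
        Real.rpow_one]
      calc |2 * x - T| / 2 * |f x - f (T - x)|
          ≤ |2 * x - T| / 2 * (C * |2 * x - T| ^ α) := by gcongr
        _ = _ := by ring
    · refine (continuous_const.mul (Continuous.rpow_const ?_ fun _ ↦
        Or.inr (by positivity))).intervalIntegrable _ _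
      fun_prop
  have hval : ∫ x in (0 : ℝ)..T, C / 2 * |2 * x - T| ^ (1 + α) =
      C / (2 * (α + 2)) * T ^ (α + 2) := by
    rw [intervalIntegral.integral_const_mul,
      integral_comp_mul_sub (fun y ↦ |y| ^ (1 + α)) two_ne_zero T, mul_zero, zero_sub,
      show 2 * T - T = T by ring, integral_abs_rpow_symm hT (by positivity),
      show 1 + α + 1 = α + 2 by ring, smul_eq_mul]
    field_simp
  rw [← hsym, hval, norm_mul, Real.norm_eq_abs, Real.norm_eq_abs, abs_two] at hbound
  have : C / (2 * (α + 2)) * T ^ (α + 2) = 2 * (C / (4 * (α + 2)) * T ^ (α + 2)) := by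
    field_simp
    ring
  linarith

theorem integral_sub_midpoint_mul_deriv {φ φ' : ℝ → ℝ} {T : ℝ} (hT : 0 ≤ T)
    (hderiv : ∀ x ∈ Icc 0 T, HasDerivWithinAt φ (φ' x) (Icc 0 T) x)
    (hφ' : IntervalIntegrable φ' volume 0 T) :
    ∫ x in (0 : ℝ)..T, (x - T / 2) * φ' x =
      T * ((φ 0 + φ T) / 2) - ∫ x in (0 : ℝ)..T, φ x := by
  rw [← uIcc_of_le hT] at hderiv
  rw [integral_mul_deriv_eq_deriv_mul_of_hasDerivWithinAt (u := fun x ↦ x - T / 2)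
    (u' := fun _ ↦ 1)
    (fun x _ ↦ ((hasDerivAt_id x).sub_const _).hasDerivWithinAt) hderiv
    intervalIntegrable_const hφ']
  simp only [one_mul]
  ring

/-- Refined trapezoid-rule estimate (Dragomir): if `φ ∈ C^{1,α}([0,T];ℝ)`, i.e. `φ` is
differentiable on `[0,T]` with `α`-Hölder continuous derivative with constant `C_e`, then
`|(φ(0)+φ(T))/2 - (1/T)∫₀^T φ| ≤ C_e/((α+2)(α+3)) · T^{1+α}`. -/
theorem refined_trapezoid_estimate
    (T : ℝ) (hT : 0 < T) (α : ℝ) (hα : α ∈ Set.Ioc (0 : ℝ) 1)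
    (C_e : ℝ) (hCe : 0 ≤ C_e) (φ φ' : ℝ → ℝ)
    (hderiv : ∀ x ∈ Set.Icc (0 : ℝ) T, HasDerivWithinAt φ (φ' x) (Set.Icc (0 : ℝ) T) x)
    (hHolder : ∀ s ∈ Set.Icc (0 : ℝ) T, ∀ x ∈ Set.Icc (0 : ℝ) T,
      |φ' x - φ' s| ≤ C_e * |x - s| ^ α) :
    |(φ 0 + φ T) / 2 - (1 / T) * ∫ ξ in (0 : ℝ)..T, φ ξ| ≤
      C_e / ((α + 2) * (α + 3)) * T ^ (1 + α) := by
  obtain ⟨hα0, hα1⟩ := hα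
  have hmoment := abs_integral_sub_midpoint_mul_le hT.le hα0 hHolder
  rw [integral_sub_midpoint_mul_deriv hT.le hderiv
    ((continuousOn_of_abs_sub_le_mul_rpow hα0 hHolder).intervalIntegrable_of_Icc hT.le)] at hmoment
  have hscale : (φ 0 + φ T) / 2 - (1 / T) * ∫ ξ in (0 : ℝ)..T, φ ξ =
      (T * ((φ 0 + φ T) / 2) - ∫ ξ in (0 : ℝ)..T, φ ξ) / T := by
    field_simp
  rw [hscale, abs_div, abs_of_pos hT, div_le_iff₀ hT]
  have hpow : T ^ (α + 2) = T ^ (1 + α) * T := by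
    rw [← Real.rpow_add_one hT.ne']
    ring_nf
  rw [hpow, ← mul_assoc] at hmoment
  refine hmoment.trans ?_
  gcongr ?_ * _ * _
  refine div_le_div_of_nonneg_left hCe (by positivity) ?_
  nlinarith
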